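/- For every integer d ≥ 1, every real-valued Schwartz function F on ℝ^{2d}, and all α, β > 0, one has ∑_{i=1}^d Θ_{h^i_α, g_β}(F) ≤ π ‖F‖_{L⁴}⁴; in particular the constant is absolute, i.e. independent of α, β, d and F. -/

import Mathlib

open MeasureTheory

/-- `L¹`-normalized dilate `f_t(x) = t^{-d} f(t^{-1} x)`. -/
noncomputable def dil {d : ℕ} (t : ℝ) (f : (Fin d → ℝ) → ℝ) : (Fin d → ℝ) → ℝ :=
  fun x => (t ^ d)⁻¹ * f (t⁻¹ • x)

/-- The singular integral form `Θ_{ψ,φ}(F)`. -/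
noncomputable def Theta {d : ℕ} (ψ φ : (Fin d → ℝ) → ℝ)
    (F : (Fin d → ℝ) × (Fin d → ℝ) → ℝ) : ℝ :=
  ∫ t in Set.Ioi (0 : ℝ),
    (∫ q : Fin d → ℝ, ∫ p : Fin d → ℝ, ∫ x : Fin d → ℝ, ∫ y : Fin d → ℝ,
      ∫ x' : Fin d → ℝ, ∫ y' : Fin d → ℝ,
        F (x, x') * F (x, y') * F (y, x') * F (y, y') *
          dil t ψ (x - q) * dil t ψ (y - q) * dil t φ (x' - p) * dil t φ (y' - p)) / t

/-- The standard Gaussian `g(x) = e^{-π ‖x‖²}` on `ℝ^d`. -/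
noncomputable def gauss (d : ℕ) : (Fin d → ℝ) → ℝ :=
  fun x => Real.exp (-Real.pi * ∑ i, x i ^ 2)

/-- `h^i = ∂_i g`, the `i`-th partial derivative of the standard Gaussian. -/
noncomputable def gaussDeriv (d : ℕ) (i : Fin d) : (Fin d → ℝ) → ℝ :=
  fun x => fderiv ℝ (gauss d) x (Pi.single i 1)


/-- A nonnegative derivative of a function with oscillation at most `M` on `(0, ∞)` is integrable
there, with integral at most `M`. -/
theorem integrableOn_Ioi_and_integral_le_of_hasDerivAt {g g' : ℝ → ℝ} {M : ℝ}
    (hg : ∀ t, 0 < t → HasDerivAt g (g' t) t) (hnonneg : ∀ t, 0 < t → 0 ≤ g' t)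
    (hM : ∀ s t, 0 < s → 0 < t → g t - g s ≤ M) :
    IntegrableOn g' (Set.Ioi 0) ∧ ∫ t in Set.Ioi (0 : ℝ), g' t ≤ M := by
  have hcover : AECover (volume.restrict (Set.Ioi (0 : ℝ))) Filter.atTop
      (fun n : ℕ => Set.Ioi (1 / ((n : ℝ) + 1)) ∩ Set.Iic ((n : ℝ) + 1)) :=
    (aecover_Ioi_of_Ioi tendsto_one_div_add_atTop_nhds_zero_nat).inter
      (aecover_Iic (Filter.tendsto_atTop_add_const_right _ _ tendsto_natCast_atTop_atTop)).restrict
  have hpos : ∀ n : ℕ, 0 < 1 / ((n : ℝ) + 1) := fun n => by positivity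
  have hle : ∀ n : ℕ, 1 / ((n : ℝ) + 1) ≤ (n : ℝ) + 1 := fun n => by
    rw [div_le_iff₀ (by positivity)]
    nlinarith [Nat.cast_nonneg (α := ℝ) n]
  have hint : ∀ n : ℕ, IntegrableOn g' (Set.Ioc (1 / ((n : ℝ) + 1)) ((n : ℝ) + 1)) := fun n =>
    intervalIntegral.integrableOn_deriv_of_nonneg
      (fun x hx => (hg x ((hpos n).trans_le hx.1)).continuousAt.continuousWithinAt)
      (fun x hx => hg x ((hpos n).trans hx.1)) (fun x hx => hnonneg x ((hpos n).trans hx.1))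
  have hrestrict : ∀ n : ℕ, (volume.restrict (Set.Ioi (0 : ℝ))).restrict
      (Set.Ioi (1 / ((n : ℝ) + 1)) ∩ Set.Iic ((n : ℝ) + 1)) =
      volume.restrict (Set.Ioc (1 / ((n : ℝ) + 1)) ((n : ℝ) + 1)) := fun n => by
    rw [Set.Ioi_inter_Iic, Measure.restrict_restrict measurableSet_Ioc, Set.inter_eq_left.2]
    exact fun x hx => (hpos n).trans hx.1
  have hbound : ∀ n : ℕ, ∫ t in Set.Ioi (1 / ((n : ℝ) + 1)) ∩ Set.Iic ((n : ℝ) + 1), g' t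
      ∂(volume.restrict (Set.Ioi (0 : ℝ))) ≤ M := fun n => by
    rw [hrestrict, ← intervalIntegral.integral_of_le (hle n),
      intervalIntegral.integral_eq_sub_of_hasDerivAt (f := g)]
    · exact hM _ _ (hpos n) ((hpos n).trans_le (hle n))
    · intro x hx
      rw [Set.uIcc_of_le (hle n)] at hx
      exact hg x ((hpos n).trans_le hx.1)
    · rw [intervalIntegrable_iff_integrableOn_Ioc_of_le (hle n)]
      exact hint n
  have hI : Integrable g' (volume.restrict (Set.Ioi (0 : ℝ))) :=
    hcover.integrable_of_integral_bounded_of_nonneg_ae M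
      (fun n => by rw [IntegrableOn, hrestrict]; exact hint n)
      ((ae_restrict_iff' measurableSet_Ioi).2 (Filter.Eventually.of_forall hnonneg))
      (Filter.Eventually.of_forall hbound)
  exact ⟨hI, le_of_tendsto (hcover.integral_tendsto_of_countably_generated hI)
    (Filter.Eventually.of_forall hbound)⟩

/-- No measurability of the summands is needed, since a non-integrable one has integral zero. -/
theorem sum_integral_le_of_sum_le {X ι : Type*} [MeasurableSpace X] {μ : Measure X} [Fintype ι]
    {f : ι → X → ℝ} {H : X → ℝ} (hf : ∀ᵐ x ∂μ, ∀ i, 0 ≤ f i x)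
    (hle : ∀ᵐ x ∂μ, ∑ i, f i x ≤ H x) (hH : Integrable H μ) :
    ∑ i, ∫ x, f i x ∂μ ≤ ∫ x, H x ∂μ := by
  classical
  have hsplit : ∑ i, ∫ x, f i x ∂μ = ∑ i with Integrable (f i) μ, ∫ x, f i x ∂μ := by
    rw [Finset.sum_filter]
    refine Finset.sum_congr rfl fun i _ => ?_
    split_ifs with h
    · rfl
    · exact integral_undef h
  rw [hsplit, ← integral_finsetSum _ fun i hi => (Finset.mem_filter.1 hi).2]
  refine integral_mono_ae (integrable_finsetSum _ fun i hi => (Finset.mem_filter.1 hi).2) hH ?_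
  filter_upwards [hf, hle] with x hx hx'
  exact (Finset.sum_le_sum_of_subset_of_nonneg (Finset.filter_subset _ _)
    fun i _ _ => hx i).trans hx'

instance isAddLeftInvariant_volume_prod (d : ℕ) :
    (volume : Measure ((Fin d → ℝ) × (Fin d → ℝ))).IsAddLeftInvariant :=
  inferInstanceAs ((volume : Measure (Fin d → ℝ)).prod volume).IsAddLeftInvariant

/-- The integrable weight `(1 + ‖x‖)^{-(d+1)}` on `ℝ^d`. -/
noncomputable def decayWeight {d : ℕ} (x : Fin d → ℝ) : ℝ := ((1 + ‖x‖) ^ (d + 1))⁻¹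

theorem decayWeight_pos {d : ℕ} (x : Fin d → ℝ) : 0 < decayWeight x := by
  unfold decayWeight; positivity

theorem decayWeight_le_one {d : ℕ} (x : Fin d → ℝ) : decayWeight x ≤ 1 :=
  inv_le_one_of_one_le₀ (one_le_pow₀ (by linarith [norm_nonneg x]))

theorem integrable_decayWeight (d : ℕ) : Integrable (decayWeight (d := d)) := by
  have h := integrable_one_add_norm (E := Fin d → ℝ) (μ := volume) (r := ((d + 1 : ℕ) : ℝ))
    (by simp)
  refine h.congr (Filter.Eventually.of_forall fun x => ?_)
  simp only [decayWeight]
  rw [Real.rpow_neg (by positivity), Real.rpow_natCast]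

theorem decayWeight_mul_decayWeight_sub_le {d : ℕ} (x q : Fin d → ℝ) :
    decayWeight x * decayWeight (x - q) ≤ decayWeight q := by
  unfold decayWeight
  rw [← mul_inv, ← mul_pow]
  gcongr
  have : ‖q‖ ≤ ‖x‖ + ‖x - q‖ := by
    calc ‖q‖ = ‖x - (x - q)‖ := by rw [sub_sub_cancel]
      _ ≤ _ := norm_sub_le _ _
  nlinarith [mul_nonneg (norm_nonneg x) (norm_nonneg (x - q))]

/-- Continuity together with the decay of `decayWeight`. -/
def HasDecay {d : ℕ} (ψ : (Fin d → ℝ) → ℝ) : Prop :=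
  Continuous ψ ∧ ∃ C, 0 ≤ C ∧ ∀ x, |ψ x| ≤ C * decayWeight x

/-- Continuity together with the decay of the square of `decayWeight` in each of two variables. -/
def HasProdDecay {d : ℕ} (F : (Fin d → ℝ) × (Fin d → ℝ) → ℝ) : Prop :=
  Continuous F ∧ ∃ C, 0 ≤ C ∧ ∀ z, |F z| ≤ C * (decayWeight z.1 ^ 2 * decayWeight z.2 ^ 2)

theorem HasProdDecay.comp_swap {d : ℕ} {F : (Fin d → ℝ) × (Fin d → ℝ) → ℝ} (hF : HasProdDecay F) :
    HasProdDecay fun z => F z.swap := by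
  obtain ⟨hc, C, hC, hb⟩ := hF
  exact ⟨hc.comp continuous_swap, C, hC, fun z => by simpa [mul_comm] using hb z.swap⟩

theorem SchwartzMap.hasProdDecay {d : ℕ} (F : SchwartzMap ((Fin d → ℝ) × (Fin d → ℝ)) ℝ) :
    HasProdDecay fun z => F z := by
  refine ⟨F.continuous, 2 ^ (4 * (d + 1)) * ((Finset.Iic (4 * (d + 1), 0)).sup
    fun m => SchwartzMap.seminorm ℝ m.1 m.2) F, ?_, fun z => ?_⟩
  · positivity
  · have h := SchwartzMap.one_add_le_sup_seminorm_apply (𝕜 := ℝ) (m := (4 * (d + 1), 0))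
      le_rfl le_rfl F z
    rw [norm_iteratedFDeriv_zero, Real.norm_eq_abs] at h
    rw [decayWeight, decayWeight, ← mul_pow, ← mul_inv, inv_pow, ← div_eq_mul_inv,
      le_div_iff₀ (by positivity), mul_comm]
    refine le_trans ?_ h
    gcongr
    have h1 := norm_fst_le z
    have h2 := norm_snd_le z
    calc ((1 + ‖z.1‖) ^ (d + 1) * (1 + ‖z.2‖) ^ (d + 1)) ^ 2
        ≤ ((1 + ‖z‖) ^ (d + 1) * (1 + ‖z‖) ^ (d + 1)) ^ 2 := by gcongr
      _ = (1 + ‖z‖) ^ (4 * (d + 1)) := by ring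

/-- The integral over the six space variables in `Theta`. -/
noncomputable def boxForm {d : ℕ} (ψ φ : (Fin d → ℝ) → ℝ)
    (F : (Fin d → ℝ) × (Fin d → ℝ) → ℝ) : ℝ :=
  ∫ q : Fin d → ℝ, ∫ p : Fin d → ℝ, ∫ x : Fin d → ℝ, ∫ y : Fin d → ℝ,
    ∫ x' : Fin d → ℝ, ∫ y' : Fin d → ℝ,
      F (x, x') * F (x, y') * F (y, x') * F (y, y') * ψ (x - q) * ψ (y - q) * φ (x' - p) * φ (y' - p)

/-- The product of the values of `F` at the corners of the box spanned by `z` and `w`. -/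
def boxProd {d : ℕ} (F : (Fin d → ℝ) × (Fin d → ℝ) → ℝ) (z w : (Fin d → ℝ) × (Fin d → ℝ)) : ℝ :=
  F z * F (z.1, w.2) * F (w.1, z.2) * F w

/-- The box autocorrelation of `F`. -/
noncomputable def boxCorr {d : ℕ} (F : (Fin d → ℝ) × (Fin d → ℝ) → ℝ)
    (c : (Fin d → ℝ) × (Fin d → ℝ)) : ℝ :=
  ∫ z, boxProd F z (z + c)

/-- The autocorrelation of `ψ`. -/
noncomputable def autoCorr {d : ℕ} (ψ : (Fin d → ℝ) → ℝ) (a : Fin d → ℝ) : ℝ :=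
  ∫ z, ψ z * ψ (z + a)

theorem boxForm_nonneg {d : ℕ} {ψ : (Fin d → ℝ) → ℝ} (hψ : ∀ x, 0 ≤ ψ x) (φ : (Fin d → ℝ) → ℝ)
    (F : (Fin d → ℝ) × (Fin d → ℝ) → ℝ) : 0 ≤ boxForm ψ φ F := by
  refine integral_nonneg fun q => integral_nonneg fun p => integral_nonneg fun x =>
    integral_nonneg fun y => ?_
  have h : ∀ x' y' : Fin d → ℝ,
      F (x, x') * F (x, y') * F (y, x') * F (y, y') * ψ (x - q) * ψ (y - q) * φ (x' - p) *
        φ (y' - p) = (ψ (x - q) * ψ (y - q) * (F (x, x') * F (y, x') * φ (x' - p))) *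
          (F (x, y') * F (y, y') * φ (y' - p)) := fun x' y' => by ring
  simp only [h, integral_const_mul, integral_mul_const, Pi.zero_apply]
  rw [mul_assoc]
  exact mul_nonneg (mul_nonneg (hψ _) (hψ _)) (mul_self_nonneg _)

theorem abs_mul_mul_le_decayWeight {d : ℕ} {ψ φ : (Fin d → ℝ) → ℝ}
    {F : (Fin d → ℝ) × (Fin d → ℝ) → ℝ} {A B C : ℝ} (hA : 0 ≤ A) (hB : 0 ≤ B) (hC : 0 ≤ C)
    (hψ : ∀ x, |ψ x| ≤ A * decayWeight x) (hφ : ∀ x, |φ x| ≤ B * decayWeight x)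
    (hF : ∀ z, |F z| ≤ C * (decayWeight z.1 ^ 2 * decayWeight z.2 ^ 2))
    (q p x x' : Fin d → ℝ) :
    |F (x, x') * ψ (x - q) * φ (x' - p)| ≤
      C * A * B * (decayWeight x * decayWeight x' * (decayWeight q * decayWeight p)) := by
  rw [abs_mul, abs_mul]
  have h0 := fun y : Fin d → ℝ => (decayWeight_pos y).le
  calc |F (x, x')| * |ψ (x - q)| * |φ (x' - p)|
      ≤ (C * (decayWeight x ^ 2 * decayWeight x' ^ 2)) * (A * decayWeight (x - q)) *
          (B * decayWeight (x' - p)) := by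
        gcongr
        · have := h0 (x - q); positivity
        · exact hF (x, x')
        · exact hψ _
        · exact hφ _
    _ = C * A * B * (decayWeight x * decayWeight x' * ((decayWeight x * decayWeight (x - q)) *
          (decayWeight x' * decayWeight (x' - p)))) := by ring
    _ ≤ _ := by
        have h1 := h0 x
        have h2 := h0 x'
        have h3 := h0 (x' - p)
        have h4 := h0 q
        gcongr <;> exact decayWeight_mul_decayWeight_sub_le _ _

theorem HasProdDecay.bounded {d : ℕ} {F : (Fin d → ℝ) × (Fin d → ℝ) → ℝ} {C : ℝ} (hC : 0 ≤ C)
    (hF : ∀ z, |F z| ≤ C * (decayWeight z.1 ^ 2 * decayWeight z.2 ^ 2)) (z) : |F z| ≤ C :=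
  (hF z).trans <| mul_le_of_le_one_right hC <| mul_le_one₀
    (pow_le_one₀ (decayWeight_pos _).le (decayWeight_le_one _)) (by positivity)
    (pow_le_one₀ (decayWeight_pos _).le (decayWeight_le_one _))

/-- The integrand of `boxForm`, with the variables grouped in pairs. -/
def boxIntegrand {d : ℕ} (ψ φ : (Fin d → ℝ) → ℝ) (F : (Fin d → ℝ) × (Fin d → ℝ) → ℝ)
    (u z w : (Fin d → ℝ) × (Fin d → ℝ)) : ℝ :=
  boxProd F z w * ((ψ (z.1 - u.1) * ψ (w.1 - u.1)) * (φ (z.2 - u.2) * φ (w.2 - u.2)))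

/-- The product weight on `ℝ^d × ℝ^d`. -/
noncomputable def prodWeight {d : ℕ} (z : (Fin d → ℝ) × (Fin d → ℝ)) : ℝ :=
  decayWeight z.1 * decayWeight z.2

theorem prodWeight_pos {d : ℕ} (z : (Fin d → ℝ) × (Fin d → ℝ)) : 0 < prodWeight z :=
  mul_pos (decayWeight_pos _) (decayWeight_pos _)

theorem prodWeight_le_one {d : ℕ} (z : (Fin d → ℝ) × (Fin d → ℝ)) : prodWeight z ≤ 1 :=
  mul_le_one₀ (decayWeight_le_one _) (decayWeight_pos _).le (decayWeight_le_one _)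

theorem integrable_prodWeight (d : ℕ) : Integrable (prodWeight (d := d)) :=
  (integrable_decayWeight d).mul_prod (integrable_decayWeight d)

theorem exists_abs_boxIntegrand_le {d : ℕ} {ψ φ : (Fin d → ℝ) → ℝ}
    {F : (Fin d → ℝ) × (Fin d → ℝ) → ℝ} (hψ : HasDecay ψ) (hφ : HasDecay φ)
    (hF : HasProdDecay F) :
    ∃ M, 0 ≤ M ∧ ∀ u z w, |boxIntegrand ψ φ F u z w| ≤
      M * (prodWeight u * (prodWeight z * prodWeight w)) := by
  obtain ⟨-, A, hA, hψ⟩ := hψ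
  obtain ⟨-, B, hB, hφ⟩ := hφ
  obtain ⟨-, C, hC, hF⟩ := hF
  refine ⟨C * C * (C * A * B) * (C * A * B), by positivity, fun u z w => ?_⟩
  have hsplit : boxIntegrand ψ φ F u z w = F (z.1, w.2) * F (w.1, z.2) *
      (F (z.1, z.2) * ψ (z.1 - u.1) * φ (z.2 - u.2)) *
      (F (w.1, w.2) * ψ (w.1 - u.1) * φ (w.2 - u.2)) := by
    simp only [boxIntegrand, boxProd]; ring
  have hz := abs_mul_mul_le_decayWeight hA hB hC hψ hφ hF u.1 u.2 z.1 z.2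
  have hw := abs_mul_mul_le_decayWeight hA hB hC hψ hφ hF u.1 u.2 w.1 w.2
  rw [hsplit, abs_mul, abs_mul, abs_mul]
  have hu := prodWeight_le_one u
  have hz0 := prodWeight_pos z
  have hw0 := prodWeight_pos w
  have hu0 := prodWeight_pos u
  change _ ≤ C * A * B * (prodWeight z * prodWeight u) at hz
  change _ ≤ C * A * B * (prodWeight w * prodWeight u) at hw
  calc _ ≤ C * C * (C * A * B * (prodWeight z * prodWeight u)) *
        (C * A * B * (prodWeight w * prodWeight u)) := by
        gcongr
        · exact HasProdDecay.bounded hC hF _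
        · exact HasProdDecay.bounded hC hF _
    _ ≤ C * C * (C * A * B * (prodWeight z * prodWeight u)) *
        (C * A * B * (prodWeight w * 1)) := by gcongr
    _ = _ := by ring

theorem continuous_boxProd {d : ℕ} {F : (Fin d → ℝ) × (Fin d → ℝ) → ℝ} (hF : Continuous F) :
    Continuous fun s : ((Fin d → ℝ) × (Fin d → ℝ)) × ((Fin d → ℝ) × (Fin d → ℝ)) =>
      boxProd F s.1 s.2 := by
  unfold boxProd; fun_prop

theorem continuous_boxIntegrand {d : ℕ} {ψ φ : (Fin d → ℝ) → ℝ}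
    {F : (Fin d → ℝ) × (Fin d → ℝ) → ℝ} (hψ : Continuous ψ) (hφ : Continuous φ)
    (hF : Continuous F) :
    Continuous fun s : ((Fin d → ℝ) × (Fin d → ℝ)) × (((Fin d → ℝ) × (Fin d → ℝ)) ×
      ((Fin d → ℝ) × (Fin d → ℝ))) => boxIntegrand ψ φ F s.1 s.2.1 s.2.2 := by
  unfold boxIntegrand boxProd; fun_prop

theorem integrable_boxIntegrand {d : ℕ} {ψ φ : (Fin d → ℝ) → ℝ}
    {F : (Fin d → ℝ) × (Fin d → ℝ) → ℝ} (hψ : HasDecay ψ) (hφ : HasDecay φ)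
    (hF : HasProdDecay F) :
    Integrable fun s : ((Fin d → ℝ) × (Fin d → ℝ)) × (((Fin d → ℝ) × (Fin d → ℝ)) ×
      ((Fin d → ℝ) × (Fin d → ℝ))) => boxIntegrand ψ φ F s.1 s.2.1 s.2.2 := by
  obtain ⟨M, -, hM⟩ := exists_abs_boxIntegrand_le hψ hφ hF
  have hw := integrable_prodWeight d
  exact ((hw.mul_prod (hw.mul_prod hw)).const_mul M).mono'
    (continuous_boxIntegrand hψ.1 hφ.1 hF.1).aestronglyMeasurable
    (Filter.Eventually.of_forall fun s => hM _ _ _)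

theorem integral_boxIntegrand_eq_iterated {d : ℕ} {ψ φ : (Fin d → ℝ) → ℝ}
    {F : (Fin d → ℝ) × (Fin d → ℝ) → ℝ} (hψ : HasDecay ψ) (hφ : HasDecay φ)
    (hF : HasProdDecay F) (u : (Fin d → ℝ) × (Fin d → ℝ)) :
    ∫ x, ∫ y, ∫ x', ∫ y', boxIntegrand ψ φ F u (x, x') (y, y') =
      ∫ s : ((Fin d → ℝ) × (Fin d → ℝ)) × ((Fin d → ℝ) × (Fin d → ℝ)),
        boxIntegrand ψ φ F u s.1 s.2 := by
  obtain ⟨M, hM0, hM⟩ := exists_abs_boxIntegrand_le hψ hφ hF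
  have hc := continuous_boxIntegrand hψ.1 hφ.1 hF.1
  have hw := integrable_prodWeight d
  have hd := integrable_decayWeight d
  have hu := prodWeight_le_one u
  have hM' : ∀ z w, |boxIntegrand ψ φ F u z w| ≤ M * (prodWeight z * prodWeight w) := fun z w => by
    refine (hM u z w).trans (mul_le_mul_of_nonneg_left ?_ hM0)
    exact mul_le_of_le_one_left (mul_pos (prodWeight_pos _) (prodWeight_pos _)).le hu
  have hzw : Integrable fun s : ((Fin d → ℝ) × (Fin d → ℝ)) × ((Fin d → ℝ) × (Fin d → ℝ)) =>
      boxIntegrand ψ φ F u s.1 s.2 :=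
    ((hw.mul_prod hw).const_mul M).mono'
      (hc.comp (by fun_prop : Continuous fun s => (u, s))).aestronglyMeasurable
      (Filter.Eventually.of_forall fun s => hM' _ _)
  have hz : ∀ z, Integrable fun w => boxIntegrand ψ φ F u z w := fun z =>
    (hw.const_mul (M * prodWeight z)).mono'
      (hc.comp (by fun_prop : Continuous fun w => (u, z, w))).aestronglyMeasurable
      (Filter.Eventually.of_forall fun w => (hM' z w).trans_eq (by ring))
  have hx : ∀ x, Integrable fun s : ((Fin d → ℝ) × (Fin d → ℝ)) × (Fin d → ℝ) =>
      boxIntegrand ψ φ F u (x, s.1.2) (s.1.1, s.2) := fun x =>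
    ((((hd.mul_prod hd).mul_prod hd)).const_mul (M * decayWeight x)).mono'
      (hc.comp (by fun_prop : Continuous fun s : ((Fin d → ℝ) × (Fin d → ℝ)) × (Fin d → ℝ) =>
        (u, (x, s.1.2), (s.1.1, s.2)))).aestronglyMeasurable
      (Filter.Eventually.of_forall fun s => (hM' _ _).trans_eq (by simp only [prodWeight]; ring))
  refine Eq.trans ?_ ((integral_prod _ hzw).trans (integral_prod _ hzw.integral_prod_left)).symm
  refine integral_congr_ae (Filter.Eventually.of_forall fun x => ?_)
  change ∫ y, ∫ x', ∫ y', boxIntegrand ψ φ F u (x, x') (y, y') = _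
  rw [integral_integral_swap (hx x).integral_prod_left]
  refine integral_congr_ae (Filter.Eventually.of_forall fun x' => ?_)
  exact (integral_prod _ (hz (x, x'))).symm

/-- Fubini's theorem expresses `boxForm` through autocorrelations. -/
theorem boxForm_eq_integral_autoCorr {d : ℕ} {ψ φ : (Fin d → ℝ) → ℝ}
    {F : (Fin d → ℝ) × (Fin d → ℝ) → ℝ} (hψ : HasDecay ψ) (hφ : HasDecay φ)
    (hF : HasProdDecay F) :
    boxForm ψ φ F = ∫ c : (Fin d → ℝ) × (Fin d → ℝ),
      autoCorr ψ c.1 * autoCorr φ c.2 * boxCorr F c := by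
  have hI := integrable_boxIntegrand hψ hφ hF
  have hker : ∀ z w : (Fin d → ℝ) × (Fin d → ℝ), ∫ u, boxIntegrand ψ φ F u z w =
      boxProd F z w * (autoCorr ψ (w.1 - z.1) * autoCorr φ (w.2 - z.2)) := by
    have h1 : ∀ (χ : (Fin d → ℝ) → ℝ) (x y : Fin d → ℝ),
        ∫ q, χ (x - q) * χ (y - q) = autoCorr χ (y - x) := fun χ x y => by
      rw [autoCorr, ← integral_sub_left_eq_self _ volume x]
      refine integral_congr_ae (Filter.Eventually.of_forall fun q => ?_)
      simp only
      congr 2 <;> abel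
    intro z w
    simp only [boxIntegrand]
    rw [integral_const_mul, Measure.volume_eq_prod,
      integral_prod_mul (fun q => ψ (z.1 - q) * ψ (w.1 - q)) (fun p => φ (z.2 - p) * φ (w.2 - p)),
      h1, h1]
  have hK : Integrable fun s : ((Fin d → ℝ) × (Fin d → ℝ)) × ((Fin d → ℝ) × (Fin d → ℝ)) =>
      ∫ u, boxIntegrand ψ φ F u s.1 s.2 := hI.integral_prod_right
  have hshear : Integrable fun s : ((Fin d → ℝ) × (Fin d → ℝ)) × ((Fin d → ℝ) × (Fin d → ℝ)) =>
      boxProd F s.1 (s.1 + s.2) * (autoCorr ψ s.2.1 * autoCorr φ s.2.2) := by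
    have h := (measurePreserving_prod_add (volume : Measure ((Fin d → ℝ) × (Fin d → ℝ)))
      (volume : Measure ((Fin d → ℝ) × (Fin d → ℝ)))).integrable_comp_of_integrable hK
    simp only [hker, Function.comp_def, Prod.fst_add, Prod.snd_add, add_sub_cancel_left] at h
    exact h
  calc boxForm ψ φ F
      = ∫ q, ∫ p, ∫ x, ∫ y, ∫ x', ∫ y', boxIntegrand ψ φ F (q, p) (x, x') (y, y') := by
        unfold boxForm boxIntegrand boxProd
        congr! 12
        ring
    _ = ∫ q, ∫ p, ∫ s : ((Fin d → ℝ) × (Fin d → ℝ)) × ((Fin d → ℝ) × (Fin d → ℝ)),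
          boxIntegrand ψ φ F (q, p) s.1 s.2 := by
        simp only [integral_boxIntegrand_eq_iterated hψ hφ hF]
    _ = ∫ u, ∫ s : ((Fin d → ℝ) × (Fin d → ℝ)) × ((Fin d → ℝ) × (Fin d → ℝ)),
          boxIntegrand ψ φ F u s.1 s.2 := (integral_prod _ hI.integral_prod_left).symm
    _ = ∫ s : ((Fin d → ℝ) × (Fin d → ℝ)) × ((Fin d → ℝ) × (Fin d → ℝ)), ∫ u,
          boxIntegrand ψ φ F u s.1 s.2 := integral_integral_swap hI
    _ = ∫ z, ∫ w, ∫ u, boxIntegrand ψ φ F u z w := integral_prod _ hK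
    _ = ∫ z, ∫ c, boxProd F z (z + c) * (autoCorr ψ c.1 * autoCorr φ c.2) := by
        refine integral_congr_ae (Filter.Eventually.of_forall fun z => ?_)
        simp only [hker]
        rw [← integral_add_left_eq_self _ z]
        simp
    _ = ∫ c, ∫ z, boxProd F z (z + c) * (autoCorr ψ c.1 * autoCorr φ c.2) :=
        integral_integral_swap hshear
    _ = _ := by
        simp only [integral_mul_const, boxCorr]
        simp only [mul_comm]

theorem boxCorr_comp_swap {d : ℕ} (F : (Fin d → ℝ) × (Fin d → ℝ) → ℝ)
    (c : (Fin d → ℝ) × (Fin d → ℝ)) : boxCorr (fun z => F z.swap) c = boxCorr F c.swap := by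
  unfold boxCorr
  rw [Measure.volume_eq_prod, ← integral_prod_swap]
  refine integral_congr_ae (Filter.Eventually.of_forall fun z => ?_)
  simp only [boxProd, Prod.swap_swap, Prod.swap_prod_mk, Prod.fst_swap, Prod.snd_swap,
    Prod.fst_add, Prod.snd_add, Prod.swap_add]
  ring

theorem boxForm_comp_swap {d : ℕ} {ψ φ : (Fin d → ℝ) → ℝ}
    {F : (Fin d → ℝ) × (Fin d → ℝ) → ℝ} (hψ : HasDecay ψ) (hφ : HasDecay φ)
    (hF : HasProdDecay F) : boxForm φ ψ (fun z => F z.swap) = boxForm ψ φ F := by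
  rw [boxForm_eq_integral_autoCorr hψ hφ hF, boxForm_eq_integral_autoCorr hφ hψ hF.comp_swap,
    Measure.volume_eq_prod, ← integral_prod_swap]
  simp only [boxCorr_comp_swap, Prod.swap_swap, Prod.fst_swap, Prod.snd_swap, mul_comm]

theorem boxForm_nonneg_of_right {d : ℕ} {ψ φ : (Fin d → ℝ) → ℝ}
    {F : (Fin d → ℝ) × (Fin d → ℝ) → ℝ} (hψ : HasDecay ψ) (hφ : HasDecay φ)
    (hF : HasProdDecay F) (h0 : ∀ x, 0 ≤ φ x) : 0 ≤ boxForm ψ φ F :=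
  boxForm_comp_swap hψ hφ hF ▸ boxForm_nonneg h0 _ _

theorem exists_abs_boxProd_le {d : ℕ} {F : (Fin d → ℝ) × (Fin d → ℝ) → ℝ} (hF : HasProdDecay F) :
    ∃ C, ∀ z w, |boxProd F z w| ≤ C * prodWeight z := by
  obtain ⟨-, C, hC, hF⟩ := hF
  refine ⟨C * C * C * C, fun z w => ?_⟩
  have hb := HasProdDecay.bounded hC hF
  have h1 : |F z| ≤ C * prodWeight z := (hF z).trans <| by
    rw [← mul_pow]
    gcongr
    exact pow_le_of_le_one (prodWeight_pos z).le (prodWeight_le_one z) two_ne_zero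
  have h0 := (prodWeight_pos z).le
  rw [boxProd, abs_mul, abs_mul, abs_mul]
  calc _ ≤ C * prodWeight z * C * C * C := by gcongr <;> exact hb _
    _ = _ := by ring

theorem continuous_boxCorr {d : ℕ} {F : (Fin d → ℝ) × (Fin d → ℝ) → ℝ} (hF : HasProdDecay F) :
    Continuous (boxCorr F) := by
  obtain ⟨C, hC⟩ := exists_abs_boxProd_le hF
  have hc := continuous_boxProd hF.1
  refine continuous_of_dominated (fun c => ?_)
    (fun c => Filter.Eventually.of_forall fun z => hC z (z + c))
    ((integrable_prodWeight d).const_mul C) (Filter.Eventually.of_forall fun z => ?_)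
  · exact (hc.comp (by fun_prop : Continuous fun z => (z, z + c))).aestronglyMeasurable
  · exact hc.comp (by fun_prop : Continuous fun c => (z, z + c))

theorem HasProdDecay.integrable_pow_four {d : ℕ} {F : (Fin d → ℝ) × (Fin d → ℝ) → ℝ}
    (hF : HasProdDecay F) : Integrable fun z => |F z| ^ 4 := by
  obtain ⟨C, hC⟩ := exists_abs_boxProd_le hF
  refine ((integrable_prodWeight d).const_mul C).mono'
    (hF.1.abs.pow 4).aestronglyMeasurable (Filter.Eventually.of_forall fun z => ?_)
  refine le_trans (le_of_eq ?_) (hC z z)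
  simp only [boxProd, norm_pow, Real.norm_eq_abs, abs_abs, abs_mul, Prod.mk.eta]
  ring

/-- The inequality of arithmetic and geometric means bounds the box autocorrelation. -/
theorem abs_boxCorr_le {d : ℕ} {F : (Fin d → ℝ) × (Fin d → ℝ) → ℝ} (hF : HasProdDecay F)
    (c : (Fin d → ℝ) × (Fin d → ℝ)) : |boxCorr F c| ≤ ∫ z, |F z| ^ 4 := by
  have hI := hF.integrable_pow_four
  have hIc : ∀ e, Integrable fun z => |F (z + e)| ^ 4 := fun e => hI.comp_add_right e
  have hint : ∀ e, ∫ z, |F (z + e)| ^ 4 = ∫ z, |F z| ^ 4 := fun e =>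
    integral_add_right_eq_self (fun z => |F z| ^ 4) e
  have amgm : ∀ a b c d : ℝ, 0 ≤ a → 0 ≤ b → 0 ≤ c → 0 ≤ d →
      a * b * c * d ≤ (a ^ 4 + b ^ 4 + c ^ 4 + d ^ 4) / 4 := fun a b c d _ _ _ _ => by
    nlinarith [sq_nonneg (a * b - c * d), sq_nonneg (a ^ 2 - b ^ 2), sq_nonneg (c ^ 2 - d ^ 2)]
  calc |boxCorr F c| ≤ ∫ z, |boxProd F z (z + c)| := abs_integral_le_integral_abs
    _ ≤ ∫ z, (|F z| ^ 4 + |F (z + (0, c.2))| ^ 4 + |F (z + (c.1, 0))| ^ 4 + |F (z + c)| ^ 4) / 4 := by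
        refine integral_mono_of_nonneg (Filter.Eventually.of_forall fun z => abs_nonneg _)
          ((((hI.add (hIc _)).add (hIc _)).add (hIc _)).div_const 4)
          (Filter.Eventually.of_forall fun z => ?_)
        simp only [boxProd, abs_mul]
        have h1 : (z.1, (z + c).2) = z + (0, c.2) := by ext <;> simp
        have h2 : ((z + c).1, z.2) = z + (c.1, 0) := by ext <;> simp
        rw [h1, h2]
        exact amgm _ _ _ _ (abs_nonneg _) (abs_nonneg _) (abs_nonneg _) (abs_nonneg _)
    _ = _ := by
        have h1 := hI.add (hIc (0, c.2))
        have h2 := h1.add (hIc (c.1, 0))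
        simp only [Pi.add_def] at h1 h2
        rw [integral_div, integral_add h2 (hIc _), integral_add h1 (hIc _), integral_add hI (hIc _),
          hint, hint, hint]
        ring

theorem exists_one_add_pow_mul_exp_le (n : ℕ) {c : ℝ} (hc : 0 < c) :
    ∃ C, 0 ≤ C ∧ ∀ r : ℝ, 0 ≤ r → (1 + r) ^ n * Real.exp (-c * r ^ 2) ≤ C := by
  refine ⟨n.factorial / c ^ n * Real.exp (2 * c), by positivity, fun r hr => ?_⟩
  have h := Real.pow_div_factorial_le_exp (c * (1 + r)) (by positivity) n
  rw [div_le_iff₀ (by positivity), mul_pow] at h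
  have h' : (1 + r) ^ n ≤ n.factorial / c ^ n * Real.exp (c * (1 + r)) := by
    rw [div_mul_eq_mul_div, le_div_iff₀ (by positivity)]
    linarith
  calc (1 + r) ^ n * Real.exp (-c * r ^ 2)
      ≤ n.factorial / c ^ n * Real.exp (c * (1 + r)) * Real.exp (-c * r ^ 2) := by gcongr
    _ = n.factorial / c ^ n * Real.exp (c * (1 + r) + -c * r ^ 2) := by
        rw [mul_assoc, Real.exp_add]
    _ ≤ _ := by
        gcongr
        nlinarith [mul_nonneg hc.le (sq_nonneg (r - 1 / 2))]

theorem sq_norm_le_sum_sq {d : ℕ} (x : Fin d → ℝ) : ‖x‖ ^ 2 ≤ ∑ i, x i ^ 2 := by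
  have h0 : 0 ≤ ∑ i, x i ^ 2 := Finset.sum_nonneg fun i _ => sq_nonneg _
  rw [← Real.le_sqrt (norm_nonneg _) h0, pi_norm_le_iff_of_nonneg (Real.sqrt_nonneg _)]
  intro i
  rw [Real.norm_eq_abs, ← Real.sqrt_sq_eq_abs]
  exact Real.sqrt_le_sqrt (Finset.single_le_sum (fun j _ => sq_nonneg (x j)) (Finset.mem_univ i))

theorem hasDecay_of_abs_le_gaussian {d : ℕ} {f : (Fin d → ℝ) → ℝ} {A c : ℝ} (hf : Continuous f)
    (hA : 0 ≤ A) (hc : 0 < c)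
    (hb : ∀ x, |f x| ≤ A * ((1 + ‖x‖) * Real.exp (-c * ∑ i, x i ^ 2))) : HasDecay f := by
  obtain ⟨C, hC, h⟩ := exists_one_add_pow_mul_exp_le (d + 2) hc
  refine ⟨hf, A * C, by positivity, fun x => (hb x).trans ?_⟩
  rw [mul_assoc]
  refine mul_le_mul_of_nonneg_left ?_ hA
  rw [decayWeight, ← div_eq_mul_inv, le_div_iff₀ (by positivity)]
  calc (1 + ‖x‖) * Real.exp (-c * ∑ i, x i ^ 2) * (1 + ‖x‖) ^ (d + 1)
      = (1 + ‖x‖) ^ (d + 2) * Real.exp (-c * ∑ i, x i ^ 2) := by ring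
    _ ≤ (1 + ‖x‖) ^ (d + 2) * Real.exp (-c * ‖x‖ ^ 2) := by
        gcongr ?_ * Real.exp ?_
        nlinarith [sq_norm_le_sum_sq x]
    _ ≤ C := h _ (norm_nonneg _)

theorem gaussDeriv_apply {d : ℕ} (i : Fin d) (x : Fin d → ℝ) :
    gaussDeriv d i x = -2 * Real.pi * x i * gauss d x := by
  have h : HasFDerivAt (gauss d)
      (gauss d x • (-Real.pi • ∑ j, (2 * x j) • 
        (ContinuousLinearMap.proj (R := ℝ) (φ := fun _ : Fin d => ℝ) j))) x := by
    refine HasFDerivAt.exp (HasFDerivAt.const_mul (HasFDerivAt.fun_sum fun j _ => ?_) _)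
    have h2 := (ContinuousLinearMap.proj (R := ℝ) (φ := fun _ : Fin d => ℝ) j).hasFDerivAt
      (x := x) |>.pow 2
    simpa using h2
  rw [gaussDeriv, h.fderiv]
  simp [Pi.single_apply]
  ring

theorem continuous_gauss (d : ℕ) : Continuous (gauss d) := by unfold gauss; fun_prop

theorem continuous_gaussDeriv {d : ℕ} (i : Fin d) : Continuous (gaussDeriv d i) := by
  have h : gaussDeriv d i = fun x => -2 * Real.pi * x i * gauss d x :=
    funext (gaussDeriv_apply i)
  have := continuous_gauss d
  rw [h]
  fun_prop

theorem dil_dil {d : ℕ} (t α : ℝ) (f : (Fin d → ℝ) → ℝ) : dil t (dil α f) = dil (α * t) f := by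
  funext x
  simp only [dil, smul_smul, mul_inv, mul_pow]
  ring

theorem gauss_inv_smul {d : ℕ} (s : ℝ) (x : Fin d → ℝ) :
    gauss d (s⁻¹ • x) = Real.exp (-(Real.pi / s ^ 2) * ∑ i, x i ^ 2) := by
  simp only [gauss, Pi.smul_apply, smul_eq_mul, mul_pow, ← Finset.mul_sum, inv_pow]
  congr 1
  ring

theorem hasDecay_dil_gauss (d : ℕ) {s : ℝ} (hs : 0 < s) : HasDecay (dil s (gauss d)) := by
  have hc := continuous_gauss d
  refine hasDecay_of_abs_le_gaussian (A := (s ^ d)⁻¹) (c := Real.pi / s ^ 2)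
    (by unfold dil; fun_prop) (by positivity) (by positivity) fun x => ?_
  rw [dil, gauss_inv_smul, abs_of_pos (by positivity)]
  gcongr
  exact le_mul_of_one_le_left (Real.exp_pos _).le (by linarith [norm_nonneg x])

theorem hasDecay_dil_gaussDeriv {d : ℕ} (i : Fin d) {s : ℝ} (hs : 0 < s) :
    HasDecay (dil s (gaussDeriv d i)) := by
  have hc := continuous_gaussDeriv i
  refine hasDecay_of_abs_le_gaussian (A := (s ^ d)⁻¹ * (2 * Real.pi * s⁻¹)) (c := Real.pi / s ^ 2)
    (by unfold dil; fun_prop) (by positivity) (by positivity) fun x => ?_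
  have hx : |x i| ≤ 1 + ‖x‖ := by
    linarith [norm_le_pi_norm x i, Real.norm_eq_abs (x i)]
  have h : dil s (gaussDeriv d i) x = -((s ^ d)⁻¹ * (2 * Real.pi * s⁻¹) *
      (x i * Real.exp (-(Real.pi / s ^ 2) * ∑ i, x i ^ 2))) := by
    rw [dil, gaussDeriv_apply, gauss_inv_smul, Pi.smul_apply, smul_eq_mul]
    ring
  rw [h, abs_neg, abs_mul, abs_mul (x i), Real.abs_exp,
    abs_of_nonneg (by positivity : 0 ≤ (s ^ d)⁻¹ * (2 * Real.pi * s⁻¹))]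
  gcongr

theorem integral_sq_mul_exp_neg_mul_sq {b : ℝ} (hb : 0 < b) :
    ∫ x : ℝ, x ^ 2 * Real.exp (-b * x ^ 2) = 1 / (2 * b) * √(Real.pi / b) := by
  have hI := integrable_exp_neg_mul_sq hb
  have hI1 : Integrable fun x : ℝ => x * Real.exp (-b * x ^ 2) := integrable_mul_exp_neg_mul_sq hb
  have hI2 : Integrable fun x : ℝ => x ^ 2 * Real.exp (-b * x ^ 2) := by
    simpa using integrable_rpow_mul_exp_neg_mul_sq hb (s := 2) (by norm_num)
  have h := integral_eq_zero_of_hasDerivAt_of_integrable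
    (f := fun x : ℝ => x * Real.exp (-b * x ^ 2))
    (f' := fun x => Real.exp (-b * x ^ 2) - 2 * b * (x ^ 2 * Real.exp (-b * x ^ 2)))
    (fun x => by
      have h1 := (hasDerivAt_id x).mul (((hasDerivAt_pow 2 x).const_mul (-b)).exp)
      convert! h1 using 1
      simp
      ring) (hI.sub (hI2.const_mul _)) hI1
  rw [integral_sub hI (hI2.const_mul _), integral_const_mul, integral_gaussian] at h
  rw [div_mul_eq_mul_div, eq_div_iff (by positivity)]
  linarith

theorem exp_neg_mul_sum_sq {d : ℕ} (b : ℝ) (x : Fin d → ℝ) :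
    Real.exp (-b * ∑ i, x i ^ 2) = ∏ i, Real.exp (-b * x i ^ 2) := by
  rw [Finset.mul_sum, Real.exp_sum]

theorem sq_mul_exp_neg_mul_sum_sq {d : ℕ} (b : ℝ) (i : Fin d) (x : Fin d → ℝ) :
    x i ^ 2 * Real.exp (-b * ∑ j, x j ^ 2) =
      ∏ j, (if j = i then x j ^ 2 * Real.exp (-b * x j ^ 2) else Real.exp (-b * x j ^ 2)) := by
  have h : ∀ j, (if j = i then x j ^ 2 * Real.exp (-b * x j ^ 2) else Real.exp (-b * x j ^ 2)) =
      (if j = i then x j ^ 2 else 1) * Real.exp (-b * x j ^ 2) := fun j => by split_ifs <;> simp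
  simp only [h, Finset.prod_mul_distrib, exp_neg_mul_sum_sq]
  simp

theorem integrable_exp_neg_mul_sum_sq (d : ℕ) {b : ℝ} (hb : 0 < b) :
    Integrable fun x : Fin d → ℝ => Real.exp (-b * ∑ i, x i ^ 2) := by
  simp only [exp_neg_mul_sum_sq]
  exact Integrable.fintype_prod fun i => integrable_exp_neg_mul_sq hb

theorem integral_exp_neg_mul_sum_sq (d : ℕ) (b : ℝ) :
    ∫ x : Fin d → ℝ, Real.exp (-b * ∑ i, x i ^ 2) = √(Real.pi / b) ^ d := by
  simp only [exp_neg_mul_sum_sq]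
  rw [integral_fintype_prod_volume_eq_prod fun _ (x : ℝ) => Real.exp (-b * x ^ 2)]
  simp only [integral_gaussian, Finset.prod_const, Finset.card_univ, Fintype.card_fin]

theorem integrable_sq_mul_exp_neg_mul_sum_sq {d : ℕ} {b : ℝ} (hb : 0 < b) (i : Fin d) :
    Integrable fun x : Fin d → ℝ => x i ^ 2 * Real.exp (-b * ∑ j, x j ^ 2) := by
  simp only [sq_mul_exp_neg_mul_sum_sq]
  refine Integrable.fintype_prod (f := fun j (x : ℝ) =>
    if j = i then x ^ 2 * Real.exp (-b * x ^ 2) else Real.exp (-b * x ^ 2)) fun j => ?_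
  by_cases h : j = i
  · simpa [h] using integrable_rpow_mul_exp_neg_mul_sq hb (s := 2) (by norm_num)
  · simpa [h] using integrable_exp_neg_mul_sq hb

theorem integral_sq_mul_exp_neg_mul_sum_sq {d : ℕ} {b : ℝ} (hb : 0 < b) (i : Fin d) :
    ∫ x : Fin d → ℝ, x i ^ 2 * Real.exp (-b * ∑ j, x j ^ 2) =
      1 / (2 * b) * √(Real.pi / b) ^ d := by
  simp only [sq_mul_exp_neg_mul_sum_sq]
  rw [integral_fintype_prod_volume_eq_prod fun j (x : ℝ) =>
    if j = i then x ^ 2 * Real.exp (-b * x ^ 2) else Real.exp (-b * x ^ 2)]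
  have h : ∀ j, (∫ x : ℝ, if j = i then x ^ 2 * Real.exp (-b * x ^ 2) else Real.exp (-b * x ^ 2)) =
      (if j = i then 1 / (2 * b) else 1) * √(Real.pi / b) := fun j => by
    by_cases h : j = i
    · simp only [h, if_true, integral_sq_mul_exp_neg_mul_sq hb]
    · simp only [h, if_false, integral_gaussian, one_mul]
  simp only [h, Finset.prod_mul_distrib]
  simp

/-- The `L¹`-normalized Gaussian at scale `√2 s`, the autocorrelation of the one at scale `s`. -/
noncomputable def gaussKernel {d : ℕ} (s : ℝ) (a : Fin d → ℝ) : ℝ :=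
  ((√2 * s) ^ d)⁻¹ * Real.exp (-(Real.pi / (2 * s ^ 2)) * ∑ i, a i ^ 2)

/-- The autocorrelation of `∂_i g` at scale `s`. -/
noncomputable def gaussDerivKernel {d : ℕ} (i : Fin d) (s : ℝ) (a : Fin d → ℝ) : ℝ :=
  gaussKernel s a * (Real.pi - Real.pi ^ 2 / s ^ 2 * a i ^ 2)

theorem sqrt_pi_div_two_pi_div_sq {s : ℝ} (hs : 0 < s) :
    √(Real.pi / (2 * Real.pi / s ^ 2)) = s / √2 := by
  rw [show Real.pi / (2 * Real.pi / s ^ 2) = s ^ 2 / 2 by field_simp,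
    Real.sqrt_div (sq_nonneg s), Real.sqrt_sq hs.le]

theorem exp_mul_exp_midpoint {d : ℕ} (s : ℝ) (a w : Fin d → ℝ) :
    Real.exp (-(Real.pi / s ^ 2) * ∑ i, (w - (2⁻¹ : ℝ) • a) i ^ 2) *
      Real.exp (-(Real.pi / s ^ 2) * ∑ i, (w - (2⁻¹ : ℝ) • a + a) i ^ 2) =
    Real.exp (-(Real.pi / (2 * s ^ 2)) * ∑ i, a i ^ 2) *
      Real.exp (-(2 * Real.pi / s ^ 2) * ∑ i, w i ^ 2) := by
  rw [← Real.exp_add, ← Real.exp_add]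
  congr 1
  simp only [Finset.mul_sum, ← Finset.sum_add_distrib]
  refine Finset.sum_congr rfl fun i _ => ?_
  simp only [Pi.add_apply, Pi.sub_apply, Pi.smul_apply, smul_eq_mul]
  ring

theorem autoCorr_dil_gauss (d : ℕ) {s : ℝ} (hs : 0 < s) :
    autoCorr (dil s (gauss d)) = gaussKernel s := by
  funext a
  rw [autoCorr, ← integral_sub_right_eq_self _ ((2⁻¹ : ℝ) • a)]
  have h : ∀ w : Fin d → ℝ, dil s (gauss d) (w - (2⁻¹ : ℝ) • a) *
      dil s (gauss d) (w - (2⁻¹ : ℝ) • a + a) =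
      ((s ^ d)⁻¹ * (s ^ d)⁻¹ * Real.exp (-(Real.pi / (2 * s ^ 2)) * ∑ i, a i ^ 2)) *
        Real.exp (-(2 * Real.pi / s ^ 2) * ∑ i, w i ^ 2) := fun w => by
    rw [mul_assoc _ _ (Real.exp (-(2 * Real.pi / s ^ 2) * _)), ← exp_mul_exp_midpoint, dil, dil,
      gauss_inv_smul, gauss_inv_smul]
    ring
  simp only [h]
  rw [integral_const_mul, integral_exp_neg_mul_sum_sq, sqrt_pi_div_two_pi_div_sq hs, gaussKernel,
    div_pow, mul_pow]
  field_simp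

theorem autoCorr_dil_gaussDeriv {d : ℕ} (i : Fin d) {s : ℝ} (hs : 0 < s) :
    autoCorr (dil s (gaussDeriv d i)) = gaussDerivKernel i s := by
  funext a
  have hb : 0 < 2 * Real.pi / s ^ 2 := by positivity
  rw [autoCorr, ← integral_sub_right_eq_self _ ((2⁻¹ : ℝ) • a)]
  have h : ∀ w : Fin d → ℝ, dil s (gaussDeriv d i) (w - (2⁻¹ : ℝ) • a) *
      dil s (gaussDeriv d i) (w - (2⁻¹ : ℝ) • a + a) =
      ((s ^ d)⁻¹ * (s ^ d)⁻¹ * (4 * Real.pi ^ 2 / s ^ 2) *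
        Real.exp (-(Real.pi / (2 * s ^ 2)) * ∑ i, a i ^ 2)) *
        (w i ^ 2 * Real.exp (-(2 * Real.pi / s ^ 2) * ∑ i, w i ^ 2) -
          a i ^ 2 / 4 * Real.exp (-(2 * Real.pi / s ^ 2) * ∑ i, w i ^ 2)) := fun w => by
    have e := exp_mul_exp_midpoint s a w
    rw [← sub_mul, mul_left_comm, mul_assoc _ _ (Real.exp (-(2 * Real.pi / s ^ 2) * _)), ← e,
      dil, dil, gaussDeriv_apply, gaussDeriv_apply, gauss_inv_smul, gauss_inv_smul]
    simp only [Pi.add_apply, Pi.sub_apply, Pi.smul_apply, smul_eq_mul]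
    ring
  simp only [h]
  rw [integral_const_mul, integral_sub (integrable_sq_mul_exp_neg_mul_sum_sq hb i)
    ((integrable_exp_neg_mul_sum_sq d hb).const_mul _), integral_const_mul,
    integral_exp_neg_mul_sum_sq, integral_sq_mul_exp_neg_mul_sum_sq hb,
    sqrt_pi_div_two_pi_div_sq hs, gaussDerivKernel, gaussKernel, div_pow, mul_pow]
  field_simp
  ring

theorem gaussKernel_pos {d : ℕ} {s : ℝ} (hs : 0 < s) (a : Fin d → ℝ) : 0 < gaussKernel s a := by
  unfold gaussKernel; positivity

theorem continuous_gaussKernel (d : ℕ) (s : ℝ) : Continuous (gaussKernel (d := d) s) := by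
  unfold gaussKernel; fun_prop

theorem continuous_gaussDerivKernel {d : ℕ} (i : Fin d) (s : ℝ) :
    Continuous (gaussDerivKernel i s) := by
  have := continuous_gaussKernel d s
  unfold gaussDerivKernel; fun_prop

theorem integrable_gaussKernel (d : ℕ) {s : ℝ} (hs : 0 < s) :
    Integrable (gaussKernel (d := d) s) :=
  (integrable_exp_neg_mul_sum_sq d (by positivity)).const_mul _

theorem integrable_sq_mul_gaussKernel {d : ℕ} (i : Fin d) {s : ℝ} (hs : 0 < s) :
    Integrable fun a : Fin d → ℝ => a i ^ 2 * gaussKernel s a := by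
  refine ((integrable_sq_mul_exp_neg_mul_sum_sq (b := Real.pi / (2 * s ^ 2)) (by positivity)
    i).const_mul ((√2 * s) ^ d)⁻¹).congr (Filter.Eventually.of_forall fun a => ?_)
  simp only [gaussKernel]
  ring

theorem integrable_gaussDerivKernel {d : ℕ} (i : Fin d) {s : ℝ} (hs : 0 < s) :
    Integrable (gaussDerivKernel i s) := by
  refine (((integrable_gaussKernel d hs).const_mul Real.pi).sub
    ((integrable_sq_mul_gaussKernel i hs).const_mul (Real.pi ^ 2 / s ^ 2))).congr
    (Filter.Eventually.of_forall fun a => ?_)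
  simp only [gaussDerivKernel, Pi.sub_apply]
  ring

theorem integral_gaussKernel (d : ℕ) {s : ℝ} (hs : 0 < s) :
    ∫ a : Fin d → ℝ, gaussKernel s a = 1 := by
  simp only [gaussKernel]
  rw [integral_const_mul, integral_exp_neg_mul_sum_sq,
    show Real.pi / (Real.pi / (2 * s ^ 2)) = 2 * s ^ 2 by field_simp,
    Real.sqrt_mul zero_le_two, Real.sqrt_sq hs.le]
  exact inv_mul_cancel₀ (by positivity)

/-- The heat equation: the scale derivative of the Gaussian is a sum of autocorrelations. -/
theorem hasDerivAt_gaussKernel {d : ℕ} {α t : ℝ} (hα : 0 < α) (ht : 0 < t) (a : Fin d → ℝ) :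
    HasDerivAt (fun τ => gaussKernel (α * τ) a)
      (-(Real.pi * t)⁻¹ * ∑ i, gaussDerivKernel i (α * t) a) t := by
  have hs : HasDerivAt (fun τ => α * τ) α t := by simpa using (hasDerivAt_id t).const_mul α
  have h2 := Real.sqrt_pos.2 (zero_lt_two (α := ℝ))
  have h1 := ((hs.const_mul √2).pow d).inv (pow_pos (by positivity : 0 < √2 * (α * t)) d).ne'
  have hne : 2 * (α * t) ^ 2 ≠ 0 := by positivity
  have h3 := (((((hs.pow 2).const_mul 2).inv hne).const_mul Real.pi).neg.mul_const
    (∑ i, a i ^ 2)).exp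
  have h := h1.mul h3
  refine HasDerivAt.congr_deriv (f := fun τ => gaussKernel (α * τ) a) (h.congr_of_eventuallyEq
    (Filter.Eventually.of_forall fun τ => ?_)) ?_
  · simp [gaussKernel, div_eq_mul_inv]
  · simp only [gaussDerivKernel, gaussKernel, ← Finset.mul_sum, Finset.sum_sub_distrib,
      Finset.sum_const, Finset.card_univ, Fintype.card_fin, nsmul_eq_mul, Pi.inv_apply,
      Pi.pow_apply, Pi.neg_apply]
    rw [← div_eq_mul_inv Real.pi]
    rcases d with _ | n
    · simp
    · simp only [Nat.add_sub_cancel]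
      field_simp
      ring

theorem gaussKernel_le {d : ℕ} {s r : ℝ} (hr : 0 < r) (h1 : r / 2 ≤ s) (h2 : s ≤ 2 * r)
    (a : Fin d → ℝ) : gaussKernel s a ≤ 4 ^ d * gaussKernel (2 * r) a := by
  have hs : 0 < s := lt_of_lt_of_le (by positivity) h1
  have h0 : 0 ≤ ∑ i, a i ^ 2 := Finset.sum_nonneg fun i _ => sq_nonneg _
  unfold gaussKernel
  rw [← mul_assoc]
  gcongr ?_ * Real.exp (-?_ * _)
  · rw [← div_eq_mul_inv, ← div_pow, ← inv_pow]
    gcongr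
    rw [inv_le_comm₀ (by positivity) (by positivity), inv_div, div_le_iff₀ (by positivity)]
    have := Real.sqrt_pos.2 (zero_lt_two (α := ℝ))
    nlinarith
  · gcongr

/-- A bound for `gaussDerivKernel` uniform for scales comparable to `r`. -/
noncomputable def gaussDerivKernelBound {d : ℕ} (i : Fin d) (r : ℝ) (a : Fin d → ℝ) : ℝ :=
  4 ^ d * gaussKernel (2 * r) a * (Real.pi + 4 * Real.pi ^ 2 / r ^ 2 * a i ^ 2)

theorem abs_gaussDerivKernel_le {d : ℕ} (i : Fin d) {s r : ℝ} (hr : 0 < r) (h1 : r / 2 ≤ s)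
    (h2 : s ≤ 2 * r) (a : Fin d → ℝ) :
    |gaussDerivKernel i s a| ≤ gaussDerivKernelBound i r a := by
  have hs : 0 < s := lt_of_lt_of_le (by positivity) h1
  have hk := gaussKernel_pos hs a
  have hk2 := gaussKernel_pos (by positivity : 0 < 2 * r) a
  rw [gaussDerivKernel, abs_mul, abs_of_pos hk, gaussDerivKernelBound]
  refine mul_le_mul (gaussKernel_le hr h1 h2 a) ?_ (abs_nonneg _) (by positivity)
  refine (abs_sub _ _).trans ?_
  rw [abs_of_pos Real.pi_pos, abs_of_nonneg (by positivity)]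
  gcongr Real.pi + ?_ * _
  rw [div_le_div_iff₀ (by positivity) (by positivity)]
  have : r ^ 2 ≤ 4 * s ^ 2 := by nlinarith
  nlinarith [mul_le_mul_of_nonneg_left this (sq_nonneg Real.pi)]

theorem integrable_gaussDerivKernelBound {d : ℕ} (i : Fin d) {r : ℝ} (hr : 0 < r) :
    Integrable (gaussDerivKernelBound i r) := by
  have h2 : 0 < 2 * r := by positivity
  refine (((integrable_gaussKernel d h2).const_mul (4 ^ d * Real.pi)).add
    ((integrable_sq_mul_gaussKernel i h2).const_mul (4 ^ d * (4 * Real.pi ^ 2 / r ^ 2)))).congr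
    (Filter.Eventually.of_forall fun a => ?_)
  simp only [gaussDerivKernelBound, Pi.add_apply]
  ring

/-- The box form of two Gaussians at scales `α t` and `β t`, as a function of `t`. -/
noncomputable def gaussForm {d : ℕ} (Ψ : (Fin d → ℝ) × (Fin d → ℝ) → ℝ) (α β t : ℝ) : ℝ :=
  ∫ c : (Fin d → ℝ) × (Fin d → ℝ), gaussKernel (α * t) c.1 * gaussKernel (β * t) c.2 * Ψ c

theorem MeasureTheory.Integrable.mul_prod_mul_of_abs_le {d : ℕ} {k l : (Fin d → ℝ) → ℝ}
    {Ψ : (Fin d → ℝ) × (Fin d → ℝ) → ℝ} {M : ℝ} (hk : Integrable k) (hl : Integrable l)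
    (hΨ : Continuous Ψ) (hM : ∀ c, |Ψ c| ≤ M) :
    Integrable fun c : (Fin d → ℝ) × (Fin d → ℝ) => k c.1 * l c.2 * Ψ c :=
  (hk.mul_prod hl).mul_bdd hΨ.aestronglyMeasurable (Filter.Eventually.of_forall hM)

theorem hasDerivAt_gaussForm {d : ℕ} {Ψ : (Fin d → ℝ) × (Fin d → ℝ) → ℝ} {M α β t : ℝ}
    (hΨ : Continuous Ψ) (hM : ∀ c, |Ψ c| ≤ M) (hα : 0 < α) (hβ : 0 < β) (ht : 0 < t) :
    HasDerivAt (gaussForm Ψ α β)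
      (-(Real.pi * t)⁻¹ * ∑ i,
        ((∫ c : (Fin d → ℝ) × (Fin d → ℝ),
          gaussDerivKernel i (α * t) c.1 * gaussKernel (β * t) c.2 * Ψ c) +
        ∫ c : (Fin d → ℝ) × (Fin d → ℝ),
          gaussKernel (α * t) c.1 * gaussDerivKernel i (β * t) c.2 * Ψ c)) t := by
  have hαt := mul_pos hα ht
  have hβt := mul_pos hβ ht
  have hM0 : 0 ≤ M := (abs_nonneg _).trans (hM 0)
  have hkα := integrable_gaussKernel d hαt
  have hkβ := integrable_gaussKernel d hβt
  have hI1 := fun i => (integrable_gaussDerivKernel i hαt).mul_prod_mul_of_abs_le hkβ hΨ hM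
  have hI2 := fun i => hkα.mul_prod_mul_of_abs_le (integrable_gaussDerivKernel i hβt) hΨ hM
  let N' : ℝ → (Fin d → ℝ) × (Fin d → ℝ) → ℝ := fun τ c => -(Real.pi * τ)⁻¹ * ∑ i,
    (gaussDerivKernel i (α * τ) c.1 * gaussKernel (β * τ) c.2 * Ψ c +
      gaussKernel (α * τ) c.1 * gaussDerivKernel i (β * τ) c.2 * Ψ c)
  let B : (Fin d → ℝ) × (Fin d → ℝ) → ℝ := fun c => (Real.pi * (t / 2))⁻¹ * ∑ i,
    (gaussDerivKernelBound i (α * t) c.1 * (4 ^ d * gaussKernel (2 * (β * t)) c.2) * M +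
      (4 ^ d * gaussKernel (2 * (α * t)) c.1) * gaussDerivKernelBound i (β * t) c.2 * M)
  have hkey := hasDerivAt_integral_of_dominated_loc_of_deriv_le (𝕜 := ℝ) (μ := volume) (x₀ := t)
    (s := Set.Ioo (t / 2) (2 * t)) (bound := B)
    (F := fun τ (c : (Fin d → ℝ) × (Fin d → ℝ)) =>
      gaussKernel (α * τ) c.1 * gaussKernel (β * τ) c.2 * Ψ c) (F' := N')
    (Ioo_mem_nhds (by linarith) (by linarith))
    (Filter.Eventually.of_forall fun τ => by
      have h1 := continuous_gaussKernel d (α * τ)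
      have h2 := continuous_gaussKernel d (β * τ)
      exact (by fun_prop : Continuous _).aestronglyMeasurable)
    (hkα.mul_prod_mul_of_abs_le hkβ hΨ hM)
    (by
      have h1 := continuous_gaussKernel d (α * t)
      have h2 := continuous_gaussKernel d (β * t)
      have h3 := fun i : Fin d => continuous_gaussDerivKernel i (α * t)
      have h4 := fun i : Fin d => continuous_gaussDerivKernel i (β * t)
      exact (by fun_prop : Continuous (N' t)).aestronglyMeasurable)
    (Filter.Eventually.of_forall fun c τ hτ => ?_) ?_
    (Filter.Eventually.of_forall fun c τ hτ => ?_)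
  · refine hkey.2.congr_deriv ?_
    simp only [N']
    rw [integral_const_mul]
    congr 1
    refine (integral_finsetSum _ fun i _ => (hI1 i).add (hI2 i)).trans ?_
    exact Finset.sum_congr rfl fun i _ => integral_add (hI1 i) (hI2 i)
  · have hτ0 : 0 < τ := lt_trans (by positivity) hτ.1
    have hscale : ∀ γ : ℝ, 0 < γ → γ * t / 2 ≤ γ * τ ∧ γ * τ ≤ 2 * (γ * t) := fun γ hγ =>
      ⟨by nlinarith [hτ.1], by nlinarith [hτ.2]⟩
    obtain ⟨hα1, hα2⟩ := hscale α hα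
    obtain ⟨hβ1, hβ2⟩ := hscale β hβ
    have hpα := gaussKernel_pos (mul_pos hα hτ0) c.1
    have hpβ := gaussKernel_pos (mul_pos hβ hτ0) c.2
    have hqα := gaussKernel_pos (by positivity : 0 < 2 * (α * t)) c.1
    simp only [N', B]
    rw [norm_mul, norm_neg, Real.norm_eq_abs, abs_of_pos (by positivity : 0 < (Real.pi * τ)⁻¹)]
    refine mul_le_mul ?_ ?_ (norm_nonneg _) (by positivity)
    · have := hτ.1.le
      gcongr
    · refine (norm_sum_le _ _).trans (Finset.sum_le_sum fun i _ => (norm_add_le _ _).trans ?_)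
      simp only [Real.norm_eq_abs, abs_mul, abs_of_pos hpα, abs_of_pos hpβ]
      have hbα := abs_gaussDerivKernel_le i hαt hα1 hα2 c.1
      have hbβ := abs_gaussDerivKernel_le i hβt hβ1 hβ2 c.2
      have hbα0 := (abs_nonneg _).trans hbα
      have hbβ0 := (abs_nonneg _).trans hbβ
      have hgα := gaussKernel_le hαt hα1 hα2 c.1
      have hgβ := gaussKernel_le hβt hβ1 hβ2 c.2
      have hgβ0 := hpβ.le.trans hgβ
      have hMc := hM c
      gcongr
  · refine (integrable_finsetSum _ fun i _ => ?_).const_mul _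
    have h1 := ((integrable_gaussDerivKernelBound i hαt).mul_prod
      ((integrable_gaussKernel d (by positivity : 0 < 2 * (β * t))).const_mul (4 ^ d))).mul_const M
    have h2 := (((integrable_gaussKernel d (by positivity : 0 < 2 * (α * t))).const_mul
      (4 ^ d)).mul_prod (integrable_gaussDerivKernelBound i hβt)).mul_const M
    exact h1.add h2
  · have hτ0 : 0 < τ := lt_trans (by positivity) hτ.1
    refine (((hasDerivAt_gaussKernel hα hτ0 c.1).mul
      (hasDerivAt_gaussKernel hβ hτ0 c.2)).mul_const (Ψ c)).congr_deriv ?_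
    simp only [N', Finset.sum_add_distrib, ← Finset.sum_mul, ← Finset.mul_sum]
    ring

theorem gaussForm_le {d : ℕ} {Ψ : (Fin d → ℝ) × (Fin d → ℝ) → ℝ} {M α β t : ℝ}
    (hΨ : Continuous Ψ) (hM : ∀ c, |Ψ c| ≤ M) (hα : 0 < α) (hβ : 0 < β) (ht : 0 < t) :
    gaussForm Ψ α β t ≤ M := by
  have hkα := integrable_gaussKernel d (mul_pos hα ht)
  have hkβ := integrable_gaussKernel d (mul_pos hβ ht)
  calc gaussForm Ψ α β t
      ≤ ∫ c : (Fin d → ℝ) × (Fin d → ℝ), gaussKernel (α * t) c.1 * gaussKernel (β * t) c.2 * M :=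
        integral_mono (hkα.mul_prod_mul_of_abs_le hkβ hΨ hM) ((hkα.mul_prod hkβ).mul_const M)
          fun c => mul_le_mul_of_nonneg_left ((le_abs_self _).trans (hM c))
            (mul_pos (gaussKernel_pos (mul_pos hα ht) _) (gaussKernel_pos (mul_pos hβ ht) _)).le
    _ = M := by
        rw [integral_mul_const, Measure.volume_eq_prod, integral_prod_mul,
          integral_gaussKernel d (mul_pos hα ht), integral_gaussKernel d (mul_pos hβ ht)]
        ring

theorem dil_gauss_nonneg {d : ℕ} {s : ℝ} (hs : 0 < s) (x : Fin d → ℝ) : 0 ≤ dil s (gauss d) x := by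
  unfold dil gauss; positivity

theorem sum_Theta_gaussians_bound (d : ℕ) (hd : 1 ≤ d)
    (F : SchwartzMap ((Fin d → ℝ) × (Fin d → ℝ)) ℝ) (α β : ℝ) (hα : 0 < α) (hβ : 0 < β) :
    ∑ i : Fin d, Theta (dil α (gaussDeriv d i)) (dil β (gauss d)) (fun z => F z) ≤
      Real.pi * ∫ z : (Fin d → ℝ) × (Fin d → ℝ), |F z| ^ 4 := by
  have hF : HasProdDecay fun z => F z := F.hasProdDecay
  have hΨ := continuous_boxCorr hF
  have hM := abs_boxCorr_le hF
  set M := ∫ z : (Fin d → ℝ) × (Fin d → ℝ), |F z| ^ 4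
  let A : Fin d → ℝ → ℝ := fun i t =>
    boxForm (dil (α * t) (gaussDeriv d i)) (dil (β * t) (gauss d)) (fun z => F z)
  let B : Fin d → ℝ → ℝ := fun i t =>
    boxForm (dil (α * t) (gauss d)) (dil (β * t) (gaussDeriv d i)) (fun z => F z)
  have hA0 : ∀ t, 0 < t → ∀ i, 0 ≤ A i t := fun t ht i =>
    boxForm_nonneg_of_right (hasDecay_dil_gaussDeriv i (mul_pos hα ht))
      (hasDecay_dil_gauss d (mul_pos hβ ht)) hF (dil_gauss_nonneg (mul_pos hβ ht))
  have hB0 : ∀ t, 0 < t → ∀ i, 0 ≤ B i t := fun t ht i =>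
    boxForm_nonneg (dil_gauss_nonneg (mul_pos hα ht)) _ _
  have hderiv : ∀ t, 0 < t → HasDerivAt
      (fun τ => -(Real.pi * gaussForm (boxCorr fun z => F z) α β τ)) ((∑ i, (A i t + B i t)) / t) t := by
    intro t ht
    refine ((hasDerivAt_gaussForm hΨ hM hα hβ ht).const_mul Real.pi).neg.congr_deriv ?_
    have hA : ∀ i, A i t = ∫ c : (Fin d → ℝ) × (Fin d → ℝ), gaussDerivKernel i (α * t) c.1 *
        gaussKernel (β * t) c.2 * boxCorr (fun z => F z) c := fun i => by
      simp only [A]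
      rw [boxForm_eq_integral_autoCorr (hasDecay_dil_gaussDeriv i (mul_pos hα ht))
        (hasDecay_dil_gauss d (mul_pos hβ ht)) hF, autoCorr_dil_gaussDeriv i (mul_pos hα ht),
        autoCorr_dil_gauss d (mul_pos hβ ht)]
    have hB : ∀ i, B i t = ∫ c : (Fin d → ℝ) × (Fin d → ℝ), gaussKernel (α * t) c.1 *
        gaussDerivKernel i (β * t) c.2 * boxCorr (fun z => F z) c := fun i => by
      simp only [B]
      rw [boxForm_eq_integral_autoCorr (hasDecay_dil_gauss d (mul_pos hα ht))
        (hasDecay_dil_gaussDeriv i (mul_pos hβ ht)) hF, autoCorr_dil_gaussDeriv i (mul_pos hβ ht),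
        autoCorr_dil_gauss d (mul_pos hα ht)]
    simp only [hA, hB]
    field_simp
  have hG0 : ∀ t, 0 < t → 0 ≤ gaussForm (boxCorr fun z => F z) α β t := fun t ht => by
    rw [gaussForm, ← autoCorr_dil_gauss d (mul_pos hα ht), ← autoCorr_dil_gauss d (mul_pos hβ ht),
      ← boxForm_eq_integral_autoCorr (hasDecay_dil_gauss d (mul_pos hα ht))
        (hasDecay_dil_gauss d (mul_pos hβ ht)) hF]
    exact boxForm_nonneg (dil_gauss_nonneg (mul_pos hα ht)) _ _
  obtain ⟨hint, hle⟩ := integrableOn_Ioi_and_integral_le_of_hasDerivAt (M := Real.pi * M) hderiv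
    (fun t ht => div_nonneg
      (Finset.sum_nonneg fun i _ => add_nonneg (hA0 t ht i) (hB0 t ht i)) ht.le)
    (fun s t hs ht => by
      have h1 := mul_le_mul_of_nonneg_left (gaussForm_le hΨ hM hα hβ hs) Real.pi_pos.le
      have h2 := mul_nonneg Real.pi_pos.le (hG0 t ht)
      linarith)
  have hTheta : ∀ i, Theta (dil α (gaussDeriv d i)) (dil β (gauss d)) (fun z => F z) =
      ∫ t in Set.Ioi (0 : ℝ), A i t / t := fun i => by
    simp only [Theta, dil_dil, A, boxForm]
  simp only [hTheta]
  refine (sum_integral_le_of_sum_le ?_ ?_ hint).trans hle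
  · exact (ae_restrict_iff' measurableSet_Ioi).2 (Filter.Eventually.of_forall
      fun t ht i => div_nonneg (hA0 t ht i) (le_of_lt ht))
  · refine (ae_restrict_iff' measurableSet_Ioi).2 (Filter.Eventually.of_forall fun t ht => ?_)
    rw [← Finset.sum_div]
    exact div_le_div_of_nonneg_right
      (Finset.sum_le_sum fun i _ => le_add_of_nonneg_right (hB0 t ht i)) (le_of_lt ht)
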